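/- Let 𝒢(V,W) be a CADMG, let q_V be a kernel that is Markov with respect to 𝒢, and let r, s ∈ 𝔽(𝒢). If φ_r(q_V; 𝒢) is Markov with respect to φ_r(𝒢) and φ_s(q_V; 𝒢) is Markov with respect to φ_s(𝒢), then φ_r ∘ φ_s(𝒢) = φ_s ∘ φ_r(𝒢) and φ_r ∘ φ_s(q_V; 𝒢) = φ_s ∘ φ_r(q_V; 𝒢). -/

import Mathlib

open scoped Classical
open Finset

namespace Nested

/-- A directed mixed graph: directed (`dir`) and bidirected (`bi`) edges. -/
structure MixedGraph (Vt : Type) where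
  dir : Vt → Vt → Prop
  bi : Vt → Vt → Prop

/-- A step along a path: an edge traversed from `src` to `tgt`, with Booleans
recording whether there is an arrowhead at the `src` (resp. `tgt`) end. -/
structure Step (Vt : Type) where
  src : Vt
  tgt : Vt
  hsrc : Bool
  htgt : Bool

/-- The step corresponds to an actual edge of the mixed graph `M`. -/
def StepIn {Vt : Type} (M : MixedGraph Vt) (s : Step Vt) : Prop :=
  (s.hsrc = false ∧ s.htgt = true ∧ M.dir s.src s.tgt) ∨
  (s.hsrc = true ∧ s.htgt = false ∧ M.dir s.tgt s.src) ∨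
  (s.hsrc = true ∧ s.htgt = true ∧ M.bi s.src s.tgt)

/-- `IsWalk M a p b`: `p` is a walk in `M` from `a` to `b`. -/
def IsWalk {Vt : Type} (M : MixedGraph Vt) : Vt → List (Step Vt) → Vt → Prop
  | a, [], b => a = b
  | a, s :: p, b => s.src = a ∧ StepIn M s ∧ IsWalk M s.tgt p b

/-- The list of vertices visited by a walk starting at `a`. -/
def wverts {Vt : Type} (a : Vt) (p : List (Step Vt)) : List Vt :=
  a :: p.map Step.tgt

/-- The non-endpoint (interior) vertices of a walk. -/
def interiorVerts {Vt : Type} (p : List (Step Vt)) : List Vt :=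
  (p.map Step.tgt).dropLast

variable {Vt : Type} [Fintype Vt] [DecidableEq Vt]

/-- `z` is an ancestor (via directed edges) of some element of `C`. -/
def ancOf (M : MixedGraph Vt) (C : Finset Vt) (z : Vt) : Prop :=
  ∃ c ∈ C, Relation.ReflTransGen M.dir z c

/-- The common vertex of two consecutive steps is a collider. -/
def Collider {Vt : Type} (s t : Step Vt) : Prop := s.htgt = true ∧ t.hsrc = true

/-- The interior vertex shared by consecutive steps `s`, `t` satisfies the
m-connection requirement given `C`: colliders are ancestors of `C`,
non-colliders lie outside `C`. -/
def jointOK (M : MixedGraph Vt) (C : Finset Vt) (s t : Step Vt) : Prop :=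
  (Collider s t ∧ ancOf M C s.tgt) ∨ (¬ Collider s t ∧ s.tgt ∉ C)

/-- `a` and `b` are m-connected given `C` in `M`: there is a path (walk with
distinct vertices) from `a` to `b` every non-collider of which avoids `C` and
every collider of which is an ancestor of `C`. -/
def MConn (M : MixedGraph Vt) (C : Finset Vt) (a b : Vt) : Prop :=
  ∃ p : List (Step Vt), IsWalk M a p b ∧ (wverts a p).Nodup ∧
    List.Chain' (jointOK M C) p

/-- m-separation of the sets `A` and `B` given `C` in `M`. -/
def MSep (M : MixedGraph Vt) (A B C : Finset Vt) : Prop :=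
  ∀ a ∈ A, ∀ b ∈ B, ¬ MConn M C a b

/-- There is a directed path from `v` to `w` in `M` all of whose
non-endpoint vertices lie in `L`. -/
def DirVia (M : MixedGraph Vt) (L : Finset Vt) (v w : Vt) : Prop :=
  ∃ p : List (Step Vt), p ≠ [] ∧ IsWalk M v p w ∧ (wverts v p).Nodup ∧
    (∀ s ∈ p, s.hsrc = false ∧ s.htgt = true) ∧
    (∀ z ∈ interiorVerts p, z ∈ L)

/-- There is a path between `v` and `w` in `M` with arrowheads at both
endpoints, all of whose non-endpoint vertices are non-colliders lying in `L`. -/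
def BiVia (M : MixedGraph Vt) (L : Finset Vt) (v w : Vt) : Prop :=
  ∃ p : List (Step Vt), p ≠ [] ∧ IsWalk M v p w ∧ (wverts v p).Nodup ∧
    (∀ s, p.head? = some s → s.hsrc = true) ∧
    (∀ s, p.getLast? = some s → s.htgt = true) ∧
    (∀ z ∈ interiorVerts p, z ∈ L) ∧
    List.Chain' (fun s t => ¬ Collider s t) p

/-- A (pre-)conditional acyclic directed mixed graph: a mixed graph together
with disjoint finite sets `V` of random and `W` of fixed vertices.  The
well-formedness conditions are collected in `PreCADMG.WF`. -/
structure PreCADMG (Vt : Type) where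
  dir : Vt → Vt → Prop
  bi : Vt → Vt → Prop
  V : Finset Vt
  W : Finset Vt

/-- The underlying mixed graph of a CADMG. -/
def PreCADMG.mg {Vt : Type} (G : PreCADMG Vt) : MixedGraph Vt := ⟨G.dir, G.bi⟩

/-- Well-formedness: `V` and `W` are disjoint, `bi` is symmetric, all edges
join vertices of `V ∪ W`, directed and bidirected edges never point into `W`,
and there are no directed cycles.  (So `WF` with `W = ∅` says: ADMG.) -/
def PreCADMG.WF {Vt : Type} (G : PreCADMG Vt) : Prop :=
  Disjoint G.V G.W ∧
  (∀ a b, G.bi a b → G.bi b a) ∧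
  (∀ a b, G.dir a b → a ∈ G.V ∪ G.W ∧ b ∈ G.V) ∧
  (∀ a b, G.bi a b → a ∈ G.V ∧ b ∈ G.V) ∧
  (∀ v, ¬ Relation.TransGen G.dir v v)

/-- The district of `v`: random vertices joined to `v` by a bidirected path. -/
noncomputable def dis (G : PreCADMG Vt) (v : Vt) : Finset Vt :=
  G.V.filter (fun w => Relation.ReflTransGen G.bi v w)

/-- The set of districts of `G`. -/
noncomputable def districts (G : PreCADMG Vt) : Finset (Finset Vt) :=
  G.V.image (dis G)

/-- Descendants of `v` (including `v` itself, among the vertices of `G`). -/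
noncomputable def deF (G : PreCADMG Vt) (v : Vt) : Finset Vt :=
  (G.V ∪ G.W).filter (fun w => Relation.ReflTransGen G.dir v w)

/-- Non-descendants of `v`. -/
noncomputable def ndF (G : PreCADMG Vt) (v : Vt) : Finset Vt :=
  (G.V ∪ G.W) \ deF G v

/-- Ancestors of the set `D` (including `D`). -/
noncomputable def anS (G : PreCADMG Vt) (D : Finset Vt) : Finset Vt :=
  (G.V ∪ G.W).filter (fun a => ∃ d ∈ D, Relation.ReflTransGen G.dir a d)

/-- Parents of the set `D`. -/
noncomputable def paS (G : PreCADMG Vt) (D : Finset Vt) : Finset Vt :=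
  (G.V ∪ G.W).filter (fun a => ∃ d ∈ D, G.dir a d)

/-- Markov blanket: `mb(t) = pa(dis(t)) ∪ (dis(t) \ {t})`. -/
noncomputable def mb (G : PreCADMG Vt) (t : Vt) : Finset Vt :=
  paS G (dis G t) ∪ (dis G t).erase t

/-- `v` is fixable in `G`: `v` is random and `dis(v) ∩ de(v) = {v}`. -/
def fixable (G : PreCADMG Vt) (v : Vt) : Prop :=
  v ∈ G.V ∧ dis G v ∩ deF G v = {v}

/-- The set `𝔽(G)` of fixable vertices. -/
noncomputable def FixF (G : PreCADMG Vt) : Finset Vt :=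
  G.V.filter (fun v => fixable G v)

/-- The graph `φ_r(G)`:  `r` becomes fixed and edges with an arrowhead at `r`
are deleted. -/
def fixG (G : PreCADMG Vt) (r : Vt) : PreCADMG Vt where
  dir a b := G.dir a b ∧ b ≠ r
  bi a b := G.bi a b ∧ a ≠ r ∧ b ≠ r
  V := G.V.erase r
  W := insert r G.W

/-- The induced subgraph on `A`, preserving random/fixed status. -/
def induce (G : PreCADMG Vt) (A : Finset Vt) : PreCADMG Vt where
  dir a b := G.dir a b ∧ a ∈ A ∧ b ∈ A
  bi a b := G.bi a b ∧ a ∈ A ∧ b ∈ A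
  V := G.V ∩ A
  W := G.W ∩ A

/-- `A` is an ancestral set in `G`. -/
def Ancestral (G : PreCADMG Vt) (A : Finset Vt) : Prop :=
  A ⊆ G.V ∪ G.W ∧
  ∀ a ∈ A, ∀ b ∈ G.V ∪ G.W, Relation.ReflTransGen G.dir b a → b ∈ A

/-- `ord` is (the rank function of) a topological total ordering for `G`:
if `a ≺ b` then `a` is not a descendant of `b`. -/
def IsTopo (G : PreCADMG Vt) (ord : Vt → ℕ) : Prop :=
  Function.Injective ord ∧
  ∀ a b, ord a < ord b → ¬ Relation.ReflTransGen G.dir b a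

/-- The predecessors of `d` in the ordering `ord`. -/
noncomputable def preF (G : PreCADMG Vt) (ord : Vt → ℕ) (d : Vt) : Finset Vt :=
  (G.V ∪ G.W).filter (fun a => ord a < ord d)

/-- The graph `G^{|W}`: all pairs of fixed vertices joined by bidirected
edges. -/
def augMG (G : PreCADMG Vt) : MixedGraph Vt :=
  ⟨G.dir, fun a b => G.bi a b ∨ (a ∈ G.W ∧ b ∈ G.W ∧ a ≠ b)⟩

/-- Adjacency in the augmented graph `(G)^a`: joined in `G^{|W}` by a path on
which every non-endpoint vertex is a collider. -/
def augEdge (G : PreCADMG Vt) (a b : Vt) : Prop :=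
  a ≠ b ∧ ∃ p : List (Step Vt), p ≠ [] ∧ IsWalk (augMG G) a p b ∧
    (wverts a p).Nodup ∧ List.Chain' Collider p

/-- Undirected separation of `a` from `b` by `C` (w.r.t. adjacency `E`). -/
def USepPt (E : Vt → Vt → Prop) (C : Finset Vt) (a b : Vt) : Prop :=
  ∀ l : List Vt, l.Chain' E → l.head? = some a → l.getLast? = some b →
    l.Nodup → ∃ v ∈ l, v ∈ C

/-- Undirected separation of `A` from `B` by `C`. -/
def USep (E : Vt → Vt → Prop) (C A B : Finset Vt) : Prop :=
  ∀ a ∈ A, ∀ b ∈ B, USepPt E C a b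

/-- The latent projection of `G` obtained by projecting out the (random)
vertices in `H`. -/
def project (G : PreCADMG Vt) (H : Finset Vt) : PreCADMG Vt where
  dir v w := v ∈ (G.V \ H) ∪ G.W ∧ w ∈ G.V \ H ∧ v ≠ w ∧ DirVia G.mg H v w
  bi v w := v ∈ G.V \ H ∧ w ∈ G.V \ H ∧ v ≠ w ∧ BiVia G.mg H v w
  V := G.V \ H
  W := G.W

/-! ## Kernels -/

variable {𝔛 : Vt → Type} [∀ v, Fintype (𝔛 v)]

/-- Sum a function of a joint state over all assignments to the coordinates in
`S`, the remaining coordinates being given by `x`. -/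
noncomputable def sumOver (S : Finset Vt) (f : (∀ v, 𝔛 v) → ℝ) (x : ∀ v, 𝔛 v) : ℝ :=
  ∑ y : ((v : {v : Vt // v ∈ S}) → 𝔛 v.1),
    f (fun v => if h : v ∈ S then y ⟨v, h⟩ else x v)

/-- `f` depends only on the coordinates in `S`. -/
def DepOn (f : (∀ v, 𝔛 v) → ℝ) (S : Finset Vt) : Prop :=
  ∀ x y : ∀ v, 𝔛 v, (∀ v ∈ S, x v = y v) → f x = f y

/-- `q` is a kernel `q_V(x_V | x_W)`: a nonnegative function of `(x_V, x_W)`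
with `∑_{x_V} q_V(x_V | x_W) = 1` for every `x_W`. -/
def IsKernel (V W : Finset Vt) (q : (∀ v, 𝔛 v) → ℝ) : Prop :=
  (∀ x, 0 ≤ q x) ∧ DepOn q (V ∪ W) ∧ ∀ x, sumOver V q x = 1

/-- Case (a) of the definition of kernel conditional independence
`X_A ⫫ X_B | X_C [q_V]`:  `A ∩ W = ∅` and the conditional kernel
`q_V(x_A | x_B, x_C, x_{W∖(B∪C)})` is, wherever defined, a function of
`x_A, x_C` only. -/
def KIndepA (V W : Finset Vt) (q : (∀ v, 𝔛 v) → ℝ) (A B C : Finset Vt) : Prop :=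
  A ∩ W = ∅ ∧
  ∀ x y : ∀ v, 𝔛 v, (∀ v ∈ A ∪ C, x v = y v) →
    0 < sumOver (V \ (B ∪ C)) q x → 0 < sumOver (V \ (B ∪ C)) q y →
    sumOver (V \ (A ∪ B ∪ C)) q x / sumOver (V \ (B ∪ C)) q x =
      sumOver (V \ (A ∪ B ∪ C)) q y / sumOver (V \ (B ∪ C)) q y

/-- Kernel conditional independence `X_A ⫫ X_B | X_C [q_V]`. -/
def KIndep (V W : Finset Vt) (q : (∀ v, 𝔛 v) → ℝ) (A B C : Finset Vt) : Prop :=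
  KIndepA V W q A B C ∨ KIndepA V W q B A C

/-- The conditional kernel `q_V(x_d | x_T)` (as a function of the joint
state). -/
noncomputable def condOn (V : Finset Vt) (q : (∀ v, 𝔛 v) → ℝ) (d : Vt)
    (T : Finset Vt) : (∀ v, 𝔛 v) → ℝ :=
  fun x => sumOver (V \ insert d T) q x / sumOver (V \ T) q x

/-- The kernel `q*_{V∖H} = q_V / q_V(x_H | x_T, x_W)` obtained by fixing `H`. -/
noncomputable def qstar (V H T : Finset Vt) (q : (∀ v, 𝔛 v) → ℝ) :
    (∀ v, 𝔛 v) → ℝ :=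
  fun x => q x / (sumOver (V \ (H ∪ T)) q x / sumOver (V \ T) q x)

/-- The kernel fixing operation `φ_r(q; G) = q / q_V(x_r | x_{mb_G(r)})`. -/
noncomputable def fixK (G : PreCADMG Vt) (r : Vt) (q : (∀ v, 𝔛 v) → ℝ) :
    (∀ v, 𝔛 v) → ℝ :=
  fun x => q x / condOn G.V q r (mb G r) x

/-- The global Markov property for a CADMG (`q ∈ 𝒫^c_m(G)`). -/
def Pcm (G : PreCADMG Vt) (q : (∀ v, 𝔛 v) → ℝ) : Prop :=
  ∀ A B C : Finset Vt, A ⊆ G.V ∪ G.W → B ⊆ G.V ∪ G.W → C ⊆ G.V ∪ G.W →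
    Disjoint A B → Disjoint A C → Disjoint B C →
    MSep (augMG G) A B C → KIndep G.V G.W q A B C

/-- The augmented Markov property for a CADMG (`q ∈ 𝒫^c_a(G)`). -/
def Pca (G : PreCADMG Vt) (q : (∀ v, 𝔛 v) → ℝ) : Prop :=
  ∀ A B C : Finset Vt, A ⊆ G.V ∪ G.W → B ⊆ G.V ∪ G.W → C ⊆ G.V ∪ G.W →
    Disjoint A B → Disjoint A C → Disjoint B C →
    USep (augEdge (induce G (anS G (A ∪ B ∪ C)))) C A B →
    KIndep G.V G.W q A B C

/-- The local Markov property for `G` at `t`. -/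
def LocalAt (G : PreCADMG Vt) (q : (∀ v, 𝔛 v) → ℝ) (t : Vt) : Prop :=
  KIndep G.V G.W q {t} ((G.V ∪ G.W) \ insert t (mb G t)) (mb G t)

/-- The ordered local Markov property for a CADMG (`q ∈ 𝒫^c_l(G, ≺)`). -/
def Pcl (G : PreCADMG Vt) (ord : Vt → ℕ) (q : (∀ v, 𝔛 v) → ℝ) : Prop :=
  ∀ A : Finset Vt, Ancestral G A → ∀ m ∈ A, (∀ a ∈ A, ord a ≤ ord m) →
    m ∈ G.V →
    LocalAt (induce G ((G.V ∩ A) ∪ G.W)) (sumOver (G.V \ A) q) m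

/-- Tian factorization for a CADMG (`q ∈ 𝒫^c_f(G)`). -/
def Pcf (G : PreCADMG Vt) (q : (∀ v, 𝔛 v) → ℝ) : Prop :=
  ∀ A : Finset Vt, Ancestral G A →
    ∃ f : Finset Vt → ((∀ v, 𝔛 v) → ℝ),
      (∀ D ∈ districts (induce G A), IsKernel D (paS G D \ D) (f D)) ∧
      ∀ x, sumOver (G.V \ A) q x = ∏ D ∈ districts (induce G A), f D x

/-- `T^{(d,D)}_≺ = mb_G(d, an_G(D) ∩ pre_≺(d))`. -/
noncomputable def Tset (G : PreCADMG Vt) (ord : Vt → ℕ) (d : Vt)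
    (D : Finset Vt) : Finset Vt :=
  mb (induce G (insert d (anS G D ∩ preF G ord d))) d

/-- The district kernel
`q_D(x_D | x_{pa(D)∖D}) = ∏_{d ∈ D} q_V(x_d | x_{T^{(d,D)}_≺})`. -/
noncomputable def qD (G : PreCADMG Vt) (ord : Vt → ℕ)
    (q : (∀ v, 𝔛 v) → ℝ) (D : Finset Vt) : (∀ v, 𝔛 v) → ℝ :=
  fun x => ∏ d ∈ D, condOn G.V q d (Tset G ord d D) x

/-! ## Fixing sequences and nested Markov properties -/

/-- Iterated graph fixing. -/
def fixGs : PreCADMG Vt → List Vt → PreCADMG Vt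
  | G, [] => G
  | G, r :: rs => fixGs (fixG G r) rs

/-- Iterated kernel fixing. -/
noncomputable def fixKs : PreCADMG Vt → ((∀ v, 𝔛 v) → ℝ) → List Vt →
    ((∀ v, 𝔛 v) → ℝ)
  | _, q, [] => q
  | G, q, r :: rs => fixKs (fixG G r) (fixK G r q) rs

/-- A valid fixing sequence: each vertex is fixable when its turn comes. -/
def ValidSeq : PreCADMG Vt → List Vt → Prop
  | _, [] => True
  | G, r :: rs => fixable G r ∧ ValidSeq (fixG G r) rs

/-- The global nested Markov property for an ADMG. -/
def NestedGlobal (G : PreCADMG Vt) (p : (∀ v, 𝔛 v) → ℝ) : Prop :=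
  ∀ ws : List Vt, ValidSeq G ws → Pcm (fixGs G ws) (fixKs G p ws)

/-- `C` is intrinsic in `G`: a district of a reachable CADMG. -/
def Intrinsic (G : PreCADMG Vt) (C : Finset Vt) : Prop :=
  ∃ ws : List Vt, ws.Nodup ∧ ValidSeq G ws ∧ C ∈ districts (fixGs G ws)

/-- The ordered local nested Markov property for an ADMG. -/
def NestedLocal (G : PreCADMG Vt) (ord : Vt → ℕ) (p : (∀ v, 𝔛 v) → ℝ) : Prop :=
  ∀ C : Finset Vt, Intrinsic G C →
    ∀ ws : List Vt, ws.Nodup → ValidSeq G ws → ws.toFinset = G.V \ C →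
      ∀ m ∈ C, (∀ c ∈ C, ord c ≤ ord m) →
        LocalAt (fixGs G ws) (fixKs G p ws) m

end Nested

namespace Nested

section Separation

variable {Vt : Type}

theorem ancOf_mono {M : MixedGraph Vt} {C D : Finset Vt} (h : C ⊆ D) {z : Vt}
    (hz : ancOf M C z) : ancOf M D z :=
  hz.imp fun _ hc => ⟨h hc.1, hc.2⟩

variable [DecidableEq Vt]

/-- A vertex from which an m-connecting walk departs with a tail is an ancestor of the
conditioning set or of the final vertex of the walk. -/
theorem ancOf_of_tail {M : MixedGraph Vt} {C : Finset Vt} {b : Vt} :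
    ∀ {p : List (Step Vt)} {a : Vt} {e : Step Vt}, IsWalk M a (e :: p) b →
      (e :: p).IsChain (jointOK M C) → e.hsrc = false → ancOf M (insert b C) a
  | p, a, e, hw, hc, he => by
    obtain ⟨rfl, hin, hw⟩ := hw
    have hdir : e.htgt = true ∧ M.dir e.src e.tgt := by
      rcases hin with h | h | h
      · exact h.2
      · simp [he] at h
      · simp [he] at h
    suffices h : ancOf M (insert b C) e.tgt from
      h.imp fun _ hc => ⟨hc.1, hc.2.head hdir.2⟩
    cases p with
    | nil => exact ⟨b, mem_insert_self _ _, by rw [show e.tgt = b from hw]⟩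
    | cons f p =>
      have hc' := List.isChain_cons_cons.1 hc
      rcases hc'.1 with h | h
      · exact ancOf_mono (subset_insert _ _) h.2
      · refine ancOf_of_tail hw hc'.2 ?_
        by_contra hf
        exact h.1 ⟨hdir.1, by simpa using hf⟩

/-- A criterion for the absence of m-connecting walks: a set `R` of vertices that such a walk
can only run through along bidirected edges, and that it cannot leave. -/
theorem not_mConn_of_confined {M : MixedGraph Vt} {C : Finset Vt} {b : Vt} (R : Vt → Prop)
    (hbR : ¬ R b) (hbC : b ∉ C)
    (htail : ∀ u, R u → u ∉ C → ¬ ancOf M (insert b C) u)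
    (hdir : ∀ u v, R u → M.dir v u → v ∈ C)
    (hbi : ∀ u v, R u → M.bi u v → ancOf M (insert b C) v → R v)
    {a : Vt} (ha : R a) (haC : a ∉ C) : ¬ MConn M C a b := by
  have key : ∀ (p : List (Step Vt)) (u : Vt), R u → IsWalk M u p b →
      p.IsChain (jointOK M C) → (∀ e ∈ p.head?, e.hsrc = true) → False := by
    intro p
    induction p with
    | nil =>
      intro u hu hw _ _
      obtain rfl : u = b := hw
      exact hbR hu
    | cons e p ih =>
      intro u hu hw hc he
      obtain ⟨rfl, hin, hw⟩ := hw
      have he : e.hsrc = true := he e rfl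
      rcases hin with h | h | h
      · simp [he] at h
      · have hv := hdir _ _ hu h.2.2
        cases p with
        | nil =>
          obtain rfl : e.tgt = b := hw
          exact hbC hv
        | cons f p =>
          rcases (List.isChain_cons_cons.1 hc).1 with h' | h'
          · simp [Collider, h.2.1] at h'
          · exact h'.2 hv
      · cases p with
        | nil =>
          have hw : e.tgt = b := hw
          exact hbR (hw ▸ hbi _ _ hu h.2.2 ⟨b, mem_insert_self _ _, by rw [hw]⟩)
        | cons f p =>
          have hc' := List.isChain_cons_cons.1 hc
          by_cases hf : f.hsrc = true
          · refine ih _ (hbi _ _ hu h.2.2 ?_) hw hc'.2 (by simpa using hf)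
            rcases hc'.1 with h' | h'
            · exact ancOf_mono (subset_insert _ _) h'.2
            · exact (h'.1 ⟨h.2.1, hf⟩).elim
          · have hanc := ancOf_of_tail hw hc'.2 (by simpa using hf)
            have hR := hbi _ _ hu h.2.2 hanc
            rcases hc'.1 with h' | h'
            · exact hf h'.1.2
            · exact htail _ hR h'.2 hanc
  rintro ⟨p, hw, -, hc⟩
  refine key p a ha hw hc ?_
  cases p with
  | nil => simp
  | cons e p =>
    intro f hf
    obtain rfl : e = f := by simpa using hf
    by_contra h
    exact htail a ha haC (ancOf_of_tail hw hc (by simpa using h))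

variable {G : PreCADMG Vt}

/-- The local Markov property as an m-separation: in an ancestral set `A`, a childless vertex
is separated from the remaining vertices by any set containing its Markov blanket in `A`. -/
theorem mSep_local (hVW : Disjoint G.V G.W) (hbi : ∀ a b, G.bi a b → a ∈ G.V ∧ b ∈ G.V)
    {A C : Finset Vt} {t : Vt} (htV : t ∈ G.V) (hA : ∀ a ∈ A, ∀ b, G.dir b a → b ∈ A)
    (hchild : ∀ a ∈ A, ¬ G.dir t a) (hCA : C ⊆ A) (htC : t ∉ C) (htA : t ∈ A)
    (hdis : ∀ u ∈ A, Relation.ReflTransGen G.bi t u → u ≠ t → u ∈ C)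
    (hpa : ∀ u ∈ A, Relation.ReflTransGen G.bi t u → ∀ p, G.dir p u → p ∈ C) :
    MSep (augMG G) {t} (A \ insert t C) C := by
  intro a ha b hb
  obtain rfl : a = t := by simpa using ha
  simp only [mem_sdiff, mem_insert, not_or] at hb
  have hancA : ∀ v, ancOf (augMG G) (insert b C) v → v ∈ A := by
    rintro v ⟨c, hc, hvc⟩
    have hcA : c ∈ A := by
      rcases mem_insert.1 hc with rfl | hc
      exacts [hb.1, hCA hc]
    induction hvc using Relation.ReflTransGen.head_induction_on with
    | refl => exact hcA
    | head h _ ih => exact hA _ ih _ h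
  have hRV : ∀ u, Relation.ReflTransGen G.bi a u → u ∈ G.V := by
    intro u hu
    rcases Relation.ReflTransGen.cases_tail hu with rfl | ⟨c, -, h⟩
    exacts [htV, (hbi _ _ h).2]
  refine not_mConn_of_confined (fun u => u ∈ A ∧ Relation.ReflTransGen G.bi a u)
    (fun h => hb.2.2 (hdis b h.1 h.2 hb.2.1)) hb.2.2 ?_ ?_ ?_ ⟨htA, .refl⟩ htC
  · rintro u ⟨huA, hu⟩ huC hanc
    obtain rfl : u = a := by
      by_contra h
      exact huC (hdis u huA hu h)
    obtain ⟨c, hc, hac⟩ := hanc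
    rcases Relation.ReflTransGen.cases_head hac with rfl | ⟨d, had, hdc⟩
    · rcases mem_insert.1 hc with rfl | hc
      exacts [hb.2.1 rfl, htC hc]
    · exact hchild d (hancA d ⟨c, hc, hdc⟩) had
  · rintro u v ⟨huA, hu⟩ hvu
    exact hpa u huA hu v hvu
  · rintro u v ⟨-, hu⟩ huv hanc
    refine ⟨hancA v hanc, hu.tail ?_⟩
    rcases huv with h | h
    · exact h
    · exact (disjoint_left.1 hVW (hRV u hu) h.1).elim

/-- After fixing `s`, the non-descendants of `s` are m-separated from `s` given the fixed
vertices. -/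
theorem mSep_fixG_self (hWF : G.WF) {s : Vt} (hs : s ∈ G.V) :
    MSep (augMG (fixG G s)) {s} (G.V \ deF G s) G.W := by
  obtain ⟨hVW, -, hdir, hbi, -⟩ := hWF
  intro a ha b hb
  obtain rfl : a = s := by simpa using ha
  simp only [mem_sdiff, deF, mem_filter, mem_union, not_and] at hb
  have hb2 := hb.2 (Or.inl hb.1)
  have haW : a ∉ G.W := disjoint_left.1 hVW hs
  have hbW : b ∉ G.W := disjoint_left.1 hVW hb.1
  have hba : b ≠ a := fun h => hb2 (h ▸ .refl)
  refine not_mConn_of_confined (fun u => u = a ∨ u ∈ G.W) (by simp [hba, hbW]) hbW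
    ?_ ?_ ?_ (Or.inl rfl) haW
  · rintro u (rfl | hu) huW ⟨c, hc, huc⟩
    · have huc' : Relation.ReflTransGen G.dir u c := 
        Relation.ReflTransGen.mono (fun _ _ h => h.1) _ _ huc
      rcases mem_insert.1 hc with rfl | hc
      · exact hb2 huc'
      · rcases Relation.ReflTransGen.cases_tail huc' with rfl | ⟨d, -, h⟩
        · exact huW hc
        · exact disjoint_left.1 hVW (hdir _ _ h).2 hc
    · exact huW hu
  · rintro u v (rfl | hu) hvu
    · exact (hvu.2 rfl).elim
    · exact (disjoint_left.1 hVW (hdir _ _ hvu.1).2 hu).elim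
  · rintro u v hu (huv | huv) -
    · rcases hu with rfl | hu
      · exact (huv.2.1 rfl).elim
      · exact (disjoint_left.1 hVW (hbi _ _ huv.1).1 hu).elim
    · exact mem_insert.1 huv.2.1

end Separation

section Sums

variable {Vt : Type} [DecidableEq Vt] {𝔛 : Vt → Type} [∀ v, Fintype (𝔛 v)]

theorem sumOver_congr {S : Finset Vt} {f g : (∀ v, 𝔛 v) → ℝ} {x : ∀ v, 𝔛 v}
    (h : ∀ y : ∀ v, 𝔛 v, (∀ v ∉ S, y v = x v) → f y = g y) :
    sumOver S f x = sumOver S g x :=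
  Finset.sum_congr rfl fun _ _ => h _ fun _ hv => dif_neg hv

theorem sumOver_eq_of_agree {S : Finset Vt} {f : (∀ v, 𝔛 v) → ℝ} {x y : ∀ v, 𝔛 v}
    (h : ∀ v ∉ S, y v = x v) : sumOver S f y = sumOver S f x := by
  refine Finset.sum_congr rfl fun z _ => ?_
  congr 1
  funext v
  split_ifs with hv
  exacts [rfl, h v hv]

theorem sumOver_const_mul (S : Finset Vt) (c : ℝ) (f : (∀ v, 𝔛 v) → ℝ) (x : ∀ v, 𝔛 v) :
    sumOver S (fun y => c * f y) x = c * sumOver S f x :=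
  (Finset.mul_sum _ _ _).symm

theorem sumOver_empty (f : (∀ v, 𝔛 v) → ℝ) (x : ∀ v, 𝔛 v) : sumOver ∅ f x = f x := by
  simp [sumOver]

theorem sumOver_nonneg {f : (∀ v, 𝔛 v) → ℝ} (hf : ∀ x, 0 ≤ f x) (S : Finset Vt)
    (x : ∀ v, 𝔛 v) : 0 ≤ sumOver S f x :=
  Finset.sum_nonneg fun _ _ => hf _

theorem sumOver_pos_iff {f : (∀ v, 𝔛 v) → ℝ} (hf : ∀ x, 0 ≤ f x) {S : Finset Vt}
    {x : ∀ v, 𝔛 v} :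
    0 < sumOver S f x ↔ ∃ y : ∀ v, 𝔛 v, (∀ v ∉ S, y v = x v) ∧ 0 < f y := by
  unfold sumOver
  rw [Finset.sum_pos_iff_of_nonneg fun _ _ => hf _]
  constructor
  · rintro ⟨y, -, hy⟩
    exact ⟨_, fun v hv => dif_neg hv, hy⟩
  · rintro ⟨y, hyx, hy⟩
    refine ⟨fun v => y v, mem_univ _, ?_⟩
    suffices h : (fun v => if v ∈ S then y v else x v) = y by simpa [h] using hy
    funext v
    split_ifs with hv
    exacts [rfl, (hyx v hv).symm]

theorem sumOver_sumOver {S T : Finset Vt} (hST : Disjoint S T) (f : (∀ v, 𝔛 v) → ℝ)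
    (x : ∀ v, 𝔛 v) : sumOver S (sumOver T f) x = sumOver (S ∪ T) f x := by
  unfold sumOver
  rw [← Finset.sum_product']
  refine Finset.sum_bij' (fun p _ v => if h : v.1 ∈ S then p.1 ⟨v, h⟩ else
      p.2 ⟨v, (mem_union.1 v.2).resolve_left h⟩)
    (fun z _ => (fun v => z ⟨v, mem_union_left _ v.2⟩, fun v => z ⟨v, mem_union_right _ v.2⟩))
    (fun _ _ => mem_univ _) (fun _ _ => mem_univ _) ?_ ?_ ?_
  · rintro ⟨y, z⟩ -
    refine Prod.ext (funext fun v => ?_) (funext fun v => ?_)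
    · simp
    · have : v.1 ∉ S := fun h => disjoint_left.1 hST h v.2
      simp [this]
  · intro z _
    funext v
    dsimp only
    split_ifs <;> rfl
  · rintro ⟨y, z⟩ -
    congr 1
    funext v
    by_cases hS : v ∈ S
    · have hT : v ∉ T := disjoint_left.1 hST hS
      simp [hS, hT]
    · by_cases hT : v ∈ T <;> simp [hS, hT]

end Sums

section Marginals

variable {Vt : Type} [DecidableEq Vt] {𝔛 : Vt → Type} [∀ v, Fintype (𝔛 v)]

/-- The margin of a kernel on the random variables `V` obtained by keeping the coordinates
in `S` and the fixed coordinates. -/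
noncomputable def marg (V : Finset Vt) (q : (∀ v, 𝔛 v) → ℝ) (S : Finset Vt) :
    (∀ v, 𝔛 v) → ℝ :=
  sumOver (V \ S) q

variable {V W : Finset Vt} {q : (∀ v, 𝔛 v) → ℝ}

theorem marg_nonneg (hq : ∀ x, 0 ≤ q x) (S : Finset Vt) (x : ∀ v, 𝔛 v) : 0 ≤ marg V q S x :=
  sumOver_nonneg hq _ x

theorem marg_pos (hq : ∀ x, 0 ≤ q x) (S : Finset Vt) {x : ∀ v, 𝔛 v} (hx : 0 < q x) :
    0 < marg V q S x :=
  (sumOver_pos_iff hq).2 ⟨x, fun _ _ => rfl, hx⟩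

theorem marg_pos_mono (hq : ∀ x, 0 ≤ q x) {S T : Finset Vt} (hTS : T ⊆ S) {x : ∀ v, 𝔛 v}
    (hx : 0 < marg V q S x) : 0 < marg V q T x := by
  obtain ⟨y, hy, hqy⟩ := (sumOver_pos_iff hq).1 hx
  exact (sumOver_pos_iff hq).2
    ⟨y, fun v hv => hy v fun h => hv (sdiff_subset_sdiff Subset.rfl hTS h), hqy⟩

theorem marg_eq_zero_mono (hq : ∀ x, 0 ≤ q x) {S T : Finset Vt} (hTS : T ⊆ S) {x : ∀ v, 𝔛 v}
    (hx : marg V q T x = 0) : marg V q S x = 0 := by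
  by_contra h
  have := marg_pos_mono hq hTS (lt_of_le_of_ne (marg_nonneg (V := V) hq S x) (Ne.symm h))
  exact this.ne' hx

theorem marg_eq_of_agree {S : Finset Vt} {x y : ∀ v, 𝔛 v} (h : ∀ v ∉ V \ S, y v = x v) :
    marg V q S y = marg V q S x :=
  sumOver_eq_of_agree h

theorem sumOver_marg {S T R : Finset Vt} (hR : R ∪ V \ S = V \ T) (hRS : Disjoint R (V \ S))
    (x : ∀ v, 𝔛 v) : sumOver R (marg V q S) x = marg V q T x := by
  unfold marg
  rw [sumOver_sumOver hRS, hR]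

theorem sumOver_singleton_marg {S : Finset Vt} {b : Vt} (hb : b ∈ S) (hbV : b ∈ V)
    (x : ∀ v, 𝔛 v) : sumOver {b} (marg V q S) x = marg V q (S.erase b) x := by
  refine sumOver_marg ?_ (by simp [hb]) x
  ext v
  simp only [mem_union, mem_singleton, mem_sdiff, mem_erase]
  grind

/-- Kernel conditional independence implies the product form of conditional independence. -/
theorem KIndepA.marg_mul_marg (hq : ∀ x, 0 ≤ q x) {A B C : Finset Vt} (hAB : Disjoint A B)
    (hBC : Disjoint B C) (h : KIndepA V W q A B C) (x : ∀ v, 𝔛 v) :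
    marg V q (A ∪ B ∪ C) x * marg V q C x = marg V q (A ∪ C) x * marg V q (B ∪ C) x := by
  obtain ⟨-, h⟩ := h
  obtain ⟨ρ, hρ⟩ : ∃ ρ : ℝ, ∀ y : ∀ v, 𝔛 v, (∀ v ∉ V ∩ B, y v = x v) →
      marg V q (A ∪ B ∪ C) y = ρ * marg V q (B ∪ C) y := by
    have hzero : ∀ y, ¬ 0 < marg V q (B ∪ C) y →
        marg V q (A ∪ B ∪ C) y = 0 ∧ marg V q (B ∪ C) y = 0 := by
      intro y hy
      have hy' : marg V q (B ∪ C) y = 0 := le_antisymm (not_lt.1 hy) (marg_nonneg hq _ y)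
      exact ⟨marg_eq_zero_mono hq (by grind) hy', hy'⟩
    by_cases hex : ∃ z : ∀ v, 𝔛 v, (∀ v ∉ V ∩ B, z v = x v) ∧ 0 < marg V q (B ∪ C) z
    · obtain ⟨z, hzx, hz⟩ := hex
      refine ⟨marg V q (A ∪ B ∪ C) z / marg V q (B ∪ C) z, fun y hyx => ?_⟩
      by_cases hy : 0 < marg V q (B ∪ C) y
      · have hv : ∀ v ∈ A ∪ C, y v = z v := by
          intro v hv
          have : v ∉ V ∩ B := by
            have h1 : v ∈ A → v ∉ B := fun hv => disjoint_left.1 hAB hv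
            have h2 : v ∈ B → v ∉ C := fun hv => disjoint_left.1 hBC hv
            grind
          rw [hyx v this, hzx v this]
        have := h y z hv hy hz
        change marg V q (A ∪ B ∪ C) y / marg V q (B ∪ C) y =
          marg V q (A ∪ B ∪ C) z / marg V q (B ∪ C) z at this
        rw [← this, div_mul_cancel₀ _ hy.ne']
      · rw [(hzero y hy).1, (hzero y hy).2, mul_zero]
    · refine ⟨0, fun y hyx => ?_⟩
      rw [(hzero y fun hy => hex ⟨y, hyx, hy⟩).1, zero_mul]
  have hAC : marg V q (A ∪ C) x = ρ * marg V q C x := by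
    rw [← sumOver_marg (R := V ∩ B) (S := A ∪ B ∪ C) (T := A ∪ C),
      ← sumOver_marg (R := V ∩ B) (S := B ∪ C) (T := C), sumOver_congr hρ, sumOver_const_mul]
    all_goals
      have h1 : ∀ v ∈ A, v ∉ B := fun _ hv => disjoint_left.1 hAB hv
      have h2 : ∀ v ∈ B, v ∉ C := fun _ hv => disjoint_left.1 hBC hv
      first
        | (ext v; grind)
        | (rw [disjoint_left]; grind)
  rw [hAC, hρ x fun _ _ => rfl]
  ring

theorem KIndep.marg_mul_marg (hq : ∀ x, 0 ≤ q x) {A B C : Finset Vt} (hAB : Disjoint A B)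
    (hAC : Disjoint A C) (hBC : Disjoint B C) (h : KIndep V W q A B C) (x : ∀ v, 𝔛 v) :
    marg V q (A ∪ B ∪ C) x * marg V q C x = marg V q (A ∪ C) x * marg V q (B ∪ C) x := by
  rcases h with h | h
  · exact h.marg_mul_marg hq hAB hBC x
  · have := h.marg_mul_marg hq hAB.symm hAC x
    rw [union_comm B A] at this
    rw [this, mul_comm]

/-- The local Markov property in product form. -/
theorem Pcm.marg_mul_marg {G : PreCADMG Vt} (hM : Pcm G q) (hq : ∀ x, 0 ≤ q x)
    (hVW : Disjoint G.V G.W) (hbi : ∀ a b, G.bi a b → a ∈ G.V ∧ b ∈ G.V)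
    {A C : Finset Vt} {t : Vt} (htV : t ∈ G.V) (hAVW : A ⊆ G.V ∪ G.W)
    (hA : ∀ a ∈ A, ∀ b, G.dir b a → b ∈ A)
    (hchild : ∀ a ∈ A, ¬ G.dir t a) (hCA : C ⊆ A) (htC : t ∉ C) (htA : t ∈ A)
    (hdis : ∀ u ∈ A, Relation.ReflTransGen G.bi t u → u ≠ t → u ∈ C)
    (hpa : ∀ u ∈ A, Relation.ReflTransGen G.bi t u → ∀ p, G.dir p u → p ∈ C)
    (x : ∀ v, 𝔛 v) :
    marg G.V q A x * marg G.V q C x =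
      marg G.V q (insert t C) x * marg G.V q (A.erase t) x := by
  have hAB : Disjoint {t} (A \ insert t C) := by simp
  have hAC : Disjoint {t} C := by simpa using htC
  have hBC : Disjoint (A \ insert t C) C := by
    rw [disjoint_left]
    grind
  have h := (hM {t} (A \ insert t C) C (by simpa using hAVW htA)
    (sdiff_subset.trans hAVW) (hCA.trans hAVW) hAB hAC hBC
    (mSep_local hVW hbi htV hA hchild hCA htC htA hdis hpa)).marg_mul_marg hq hAB hAC hBC x
  have e1 : {t} ∪ A \ insert t C ∪ C = A := by
    ext v
    have := @hCA v
    grind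
  have e2 : A \ insert t C ∪ C = A.erase t := by
    ext v
    have := @hCA v
    grind
  rwa [e1, e2, ← insert_eq] at h

end Marginals

section Fixing

variable {Vt : Type} {G : PreCADMG Vt}

theorem mem_V_of_bi (hWF : G.WF) {s u : Vt} (hs : s ∈ G.V)
    (h : Relation.ReflTransGen G.bi s u) : u ∈ G.V := by
  rcases Relation.ReflTransGen.cases_tail h with rfl | ⟨c, -, h⟩
  exacts [hs, (hWF.2.2.2.1 _ _ h).2]

variable [DecidableEq Vt]

theorem PreCADMG.WF.mem_of_dir (hWF : G.WF) {a b : Vt} (h : G.dir a b) : a ∈ G.V ∪ G.W := by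
  convert (hWF.2.2.1 _ _ h).1

theorem mem_deF (hWF : G.WF) {s v : Vt} (hs : s ∈ G.V) :
    v ∈ deF G s ↔ Relation.ReflTransGen G.dir s v := by
  simp only [deF, mem_filter, mem_union, and_iff_right_iff_imp]
  intro h
  rcases Relation.ReflTransGen.cases_tail h with rfl | ⟨c, -, h⟩
  exacts [Or.inl hs, Or.inl (hWF.2.2.1 _ _ h).2]

theorem self_mem_deF {s : Vt} (hs : s ∈ G.V) : s ∈ deF G s := by
  simp only [deF, mem_filter, mem_union]
  exact ⟨Or.inl hs, .refl⟩

theorem deF_of_dir (hWF : G.WF) {s u v : Vt} (hs : s ∈ G.V) (hu : u ∈ deF G s)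
    (huv : G.dir u v) : v ∈ deF G s :=
  (mem_deF hWF hs).2 (((mem_deF hWF hs).1 hu).tail huv)

theorem deF_subset_deF (hWF : G.WF) {r s : Vt} (hr : r ∈ G.V) (hs : s ∈ G.V)
    (h : r ∈ deF G s) : deF G r ⊆ deF G s := fun _ hv =>
  (mem_deF hWF hs).2 (((mem_deF hWF hs).1 h).trans ((mem_deF hWF hr).1 hv))

theorem not_mem_deF_of_dir (hWF : G.WF) {s u : Vt} (hs : s ∈ G.V) (hus : G.dir u s) :
    u ∉ deF G s := fun h =>
  hWF.2.2.2.2 s (Relation.TransGen.tail' ((mem_deF hWF hs).1 h) hus)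

theorem not_mem_deF_of_mem_deF (hWF : G.WF) {r s : Vt} (hr : r ∈ G.V) (hs : s ∈ G.V)
    (hrs : r ≠ s) (h : r ∈ deF G s) : s ∉ deF G r := by
  intro h'
  rw [mem_deF hWF hs] at h
  rw [mem_deF hWF hr] at h'
  rcases Relation.reflTransGen_iff_eq_or_transGen.1 h with h | h
  · exact hrs h
  · exact hWF.2.2.2.2 s (h.trans_left h')

theorem fixable.eq_of_bi (hWF : G.WF) {s u : Vt} (hs : fixable G s)
    (h : Relation.ReflTransGen G.bi s u) (hu : u ∈ deF G s) : u = s := by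
  have : u ∈ dis G s ∩ deF G s :=
    mem_inter.2 ⟨by simp only [dis, mem_filter]; exact ⟨mem_V_of_bi hWF hs.1 h, h⟩, hu⟩
  rw [hs.2] at this
  exact mem_singleton.1 this

/-- A parent of the district of a fixable vertex is not a descendant of that vertex. -/
theorem fixable.parent_not_mem_deF (hWF : G.WF) {s u p : Vt} (hs : fixable G s)
    (h : Relation.ReflTransGen G.bi s u) (hp : G.dir p u) : p ∉ deF G s := by
  intro hps
  obtain rfl := hs.eq_of_bi hWF h (deF_of_dir hWF hs.1 hps hp)
  exact not_mem_deF_of_dir hWF hs.1 hp hps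

theorem fixable.mb_subset_ndF (hWF : G.WF) {s : Vt} (hs : fixable G s) :
    mb G s ⊆ ndF G s := by
  intro v hv
  simp only [mb, paS, dis, mem_union, mem_filter, mem_erase] at hv
  simp only [ndF, mem_sdiff, mem_union]
  rcases hv with ⟨hv, d, hd, hvd⟩ | ⟨hvs, hv, hsv⟩
  · exact ⟨hv, hs.parent_not_mem_deF hWF hd.2 hvd⟩
  · exact ⟨Or.inl hv, fun h => hvs (hs.eq_of_bi hWF hsv h)⟩

theorem fixG_comm (G : PreCADMG Vt) (r s : Vt) : fixG (fixG G s) r = fixG (fixG G r) s := by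
  unfold fixG
  congr 1
  · funext a b
    simp only [eq_iff_iff]
    tauto
  · funext a b
    simp only [eq_iff_iff]
    tauto
  · exact erase_right_comm
  · exact insert_comm _ _ _

theorem mb_fixG_subset {s : Vt} (hs : s ∈ G.V) (r : Vt) : mb (fixG G s) r ⊆ mb G r := by
  have hbi : ∀ u, Relation.ReflTransGen (fixG G s).bi r u → Relation.ReflTransGen G.bi r u :=
    fun u h => Relation.ReflTransGen.mono (fun _ _ h => h.1) _ _ h
  intro v hv
  simp only [mb, paS, dis, mem_union, mem_filter, mem_erase] at hv ⊢
  rcases hv with ⟨hv, d, ⟨hd, hrd⟩, hvd⟩ | ⟨hvr, hv, hrv⟩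
  · refine Or.inl ⟨?_, d, ⟨(mem_erase.1 hd).2, hbi _ hrd⟩, hvd.1⟩
    simp only [fixG, mem_erase, mem_insert] at hv
    rcases hv with hv | rfl | hv
    exacts [Or.inl hv.2, Or.inl hs, Or.inr hv]
  · exact Or.inr ⟨hvr, (mem_erase.1 hv).2, hbi _ hrv⟩

theorem ancestral_insert_ndF (hWF : G.WF) {s : Vt} (hs : s ∈ G.V) :
    ∀ a ∈ insert s (ndF G s), ∀ b, G.dir b a → b ∈ insert s (ndF G s) := by
  intro a ha b hba
  refine mem_insert_of_mem (mem_sdiff.2 ⟨(hWF.mem_of_dir hba), fun hb => ?_⟩)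
  rcases mem_insert.1 ha with rfl | ha
  · exact not_mem_deF_of_dir hWF hs hba hb
  · exact (mem_sdiff.1 ha).2 (deF_of_dir hWF hs hb hba)

theorem ancestral_ndF (hWF : G.WF) {s : Vt} (hs : s ∈ G.V) :
    ∀ a ∈ ndF G s, ∀ b, G.dir b a → b ∈ ndF G s := fun _ ha _ hba =>
  mem_sdiff.2 ⟨(hWF.mem_of_dir hba), fun hb =>
    (mem_sdiff.1 ha).2 (deF_of_dir hWF hs hb hba)⟩

theorem subset_ndF_W (hWF : G.WF) {s : Vt} (hs : s ∈ G.V) : G.W ⊆ ndF G s := by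
  intro w hw
  refine mem_sdiff.2 ⟨mem_union_right _ hw, fun h => ?_⟩
  rcases Relation.ReflTransGen.cases_tail ((mem_deF hWF hs).1 h) with rfl | ⟨c, -, h⟩
  · exact disjoint_left.1 hWF.1 hs hw
  · exact disjoint_left.1 hWF.1 (hWF.2.2.1 _ _ h).2 hw

variable {𝔛 : Vt → Type} [∀ v, Fintype (𝔛 v)] {q : (∀ v, 𝔛 v) → ℝ}

/-- The local Markov property in product form, conditioning on the Markov blanket. -/
theorem Pcm.marg_mul_marg_mb (hM : Pcm G q) (hq : ∀ x, 0 ≤ q x)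
    (hVW : Disjoint G.V G.W) (hbi : ∀ a b, G.bi a b → a ∈ G.V ∧ b ∈ G.V)
    (hdir : ∀ a b, G.dir a b → a ∈ G.V ∪ G.W)
    {A : Finset Vt} {t : Vt} (htV : t ∈ G.V) (hAVW : A ⊆ G.V ∪ G.W)
    (hA : ∀ a ∈ A, ∀ b, G.dir b a → b ∈ A)
    (hchild : ∀ a ∈ A, ¬ G.dir t a) (hmb : mb G t ⊆ A) (htA : t ∈ A) (x : ∀ v, 𝔛 v) :
    marg G.V q A x * marg G.V q (mb G t) x =
      marg G.V q (insert t (mb G t)) x * marg G.V q (A.erase t) x := by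
  have hR : ∀ u, Relation.ReflTransGen G.bi t u → u ∈ dis G t := by
    intro u hu
    simp only [dis, mem_filter]
    refine ⟨?_, hu⟩
    rcases Relation.ReflTransGen.cases_tail hu with rfl | ⟨c, -, h⟩
    exacts [htV, (hbi _ _ h).2]
  refine hM.marg_mul_marg hq hVW hbi htV hAVW hA hchild hmb ?_ htA
    (fun u _ hu hut => mem_union_right _ (mem_erase.2 ⟨hut, hR u hu⟩))
    (fun u _ hu p hp => mem_union_left _ ?_) x
  · intro ht
    simp only [mb, paS, mem_union, mem_filter, mem_erase] at ht
    rcases ht with ⟨-, d, hd, htd⟩ | ht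
    · by_cases h : d = t
      · exact hchild t htA (h ▸ htd)
      · exact hchild d (hmb (mem_union_right _ (mem_erase.2 ⟨h, hd⟩))) htd
    · exact ht.1 rfl
  · simp only [paS, mem_filter]
    exact ⟨hdir _ _ hp, u, hR u hu, hp⟩

theorem condOn_eq_div (V : Finset Vt) (q : (∀ v, 𝔛 v) → ℝ) (d : Vt) (T : Finset Vt)
    (x : ∀ v, 𝔛 v) : condOn V q d T x = marg V q (insert d T) x / marg V q T x := rfl

/-- In the support of the kernel, conditioning a fixable vertex on its Markov blanket amounts to
conditioning it on its non-descendants. -/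
theorem condOn_mb_eq (hWF : G.WF) (hq : ∀ x, 0 ≤ q x) (hM : Pcm G q) {s : Vt}
    (hs : fixable G s) {x : ∀ v, 𝔛 v} (hx : 0 < q x) :
    condOn G.V q s (mb G s) x = marg G.V q (insert s (ndF G s)) x / marg G.V q (ndF G s) x := by
  have hsn : s ∉ ndF G s := fun h => (mem_sdiff.1 h).2 (self_mem_deF hs.1)
  have h := hM.marg_mul_marg_mb hq hWF.1 hWF.2.2.2.1 (fun _ _ h => (hWF.mem_of_dir h))
    (A := insert s (ndF G s)) hs.1
    (insert_subset (mem_union_left _ hs.1) sdiff_subset)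
    (ancestral_insert_ndF hWF hs.1) ?_
    ((hs.mb_subset_ndF hWF).trans (subset_insert _ _)) (mem_insert_self _ _) x
  · rw [erase_insert hsn] at h
    rw [condOn_eq_div, div_eq_div_iff (marg_pos hq _ hx).ne' (marg_pos hq _ hx).ne', h]
  · intro a ha hsa
    have had := deF_of_dir hWF hs.1 (self_mem_deF hs.1) hsa
    rcases mem_insert.1 ha with rfl | ha
    · exact not_mem_deF_of_dir hWF hs.1 hsa had
    · exact (mem_sdiff.1 ha).2 had

theorem fixK_nonneg (hq : ∀ x, 0 ≤ q x) (s : Vt) (x : ∀ v, 𝔛 v) : 0 ≤ fixK G s q x :=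
  div_nonneg (hq x) (div_nonneg (marg_nonneg hq _ x) (marg_nonneg hq _ x))

theorem fixK_pos_iff (hq : ∀ x, 0 ≤ q x) (s : Vt) {x : ∀ v, 𝔛 v} :
    0 < fixK G s q x ↔ 0 < q x := by
  constructor
  · intro h
    refine lt_of_le_of_ne (hq x) fun h0 => h.ne ?_
    simp [fixK, ← h0]
  · intro h
    exact div_pos h (div_pos (marg_pos hq _ h) (marg_pos hq _ h))

theorem sumOver_fixK_pos_iff (hq : ∀ x, 0 ≤ q x) (s : Vt) {S : Finset Vt} {x : ∀ v, 𝔛 v} :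
    0 < sumOver S (fixK G s q) x ↔ 0 < sumOver S q x := by
  rw [sumOver_pos_iff (fixK_nonneg hq s), sumOver_pos_iff hq]
  simp only [fixK_pos_iff hq s]

/-- If the fixed kernel is Markov, then every value of `s` of positive probability has positive
conditional probability given any non-descendants of `s`. -/
theorem marg_insert_pos (hWF : G.WF) (hq : ∀ x, 0 ≤ q x) {s : Vt} (hs : s ∈ G.V)
    (hMs : Pcm (fixG G s) (fixK G s q)) {N : Finset Vt} (hN : Disjoint N (deF G s))
    {x : ∀ v, 𝔛 v} (hxN : 0 < marg G.V q N x) (hxs : 0 < marg G.V q {s} x) :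
    0 < marg G.V q (insert s N) x := by
  have hVW := hWF.1
  have hsW : s ∉ G.W := disjoint_left.1 hVW hs
  have hsN : s ∉ N := fun h => disjoint_left.1 hN h (self_mem_deF hs)
  have hVW' : ∀ v, v ∈ G.V → v ∉ G.W := fun _ hv => disjoint_left.1 hVW hv
  have hind := hMs {s} (G.V ∩ N) G.W (by simp [fixG]) (fun v hv => ?_)
    (fun v hv => ?_) (by simp [hsN]) (by simpa using hsW) (disjoint_left.2 fun v hv =>
      hVW' v (mem_inter.1 hv).1) (fun a ha b hb => mSep_fixG_self hWF hs a ha b ?_)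
  · rcases hind with h | h
    · have : s ∈ {s} ∩ (fixG G s).W := by simp [fixG]
      rw [h.1] at this
      simp at this
    · obtain ⟨y, hyx, hqy⟩ := (sumOver_pos_iff hq).1 hxN
      have e1 : (fixG G s).V \ ({s} ∪ G.W) = G.V \ {s} := by
        ext v
        have := hVW' v
        simp only [fixG]
        grind
      have e2 : (fixG G s).V \ (G.V ∩ N ∪ {s} ∪ G.W) = G.V \ insert s N := by
        ext v
        have := hVW' v
        simp only [fixG]
        grind
      have h := h.2 x y (fun v hv => (hyx v ?_).symm)
      · rw [e1, e2] at h
        have hx1 := (sumOver_fixK_pos_iff (G := G) hq s).2 hxs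
        have hy1 := (sumOver_fixK_pos_iff (G := G) hq s (S := G.V \ {s})).2 (marg_pos hq _ hqy)
        have hy2 := (sumOver_fixK_pos_iff (G := G) hq s (S := G.V \ insert s N)).2
          (marg_pos hq _ hqy)
        have h := h hx1 hy1
        refine (sumOver_fixK_pos_iff (G := G) hq s).1 ?_
        have hpos := div_pos hy2 hy1
        rw [← h] at hpos
        exact (div_pos_iff_of_pos_right hx1).1 hpos
      · have := hVW' v
        grind
  · have : v ≠ s := by
      rintro rfl
      exact hsN (mem_inter.1 hv).2
    simp [fixG, this, (mem_inter.1 hv).1]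
  · simp [fixG, hv]
  · exact mem_sdiff.2 ⟨(mem_inter.1 hb).1, disjoint_left.1 hN (mem_inter.1 hb).2⟩

/-- Summing a childless vertex `b ≠ s` out of an ancestral margin of the fixed kernel. -/
theorem marg_fixK_erase (hWF : G.WF) (hq : ∀ x, 0 ≤ q x) (hM : Pcm G q) {s : Vt}
    (hs : fixable G s) (hMs : Pcm (fixG G s) (fixK G s q)) {A : Finset Vt} {b : Vt}
    (hAVW : A ⊆ G.V ∪ G.W) (hA : ∀ a ∈ A, ∀ b, G.dir b a → b ∈ A) (hsA : s ∈ A)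
    (hbA : b ∈ A) (hbV : b ∈ G.V) (hbs : b ≠ s) (hchild : ∀ a ∈ A, ¬ G.dir b a)
    (h : ∀ x, marg G.V (fixK G s q) A x = marg G.V q A x *
      (marg G.V q (A \ deF G s) x / marg G.V q (insert s (A \ deF G s)) x))
    (x : ∀ v, 𝔛 v) :
    marg G.V (fixK G s q) (A.erase b) x = marg G.V q (A.erase b) x *
      (marg G.V q (A.erase b \ deF G s) x /
        marg G.V q (insert s (A.erase b \ deF G s)) x) := by
  have hsd := self_mem_deF hs.1
  have hconst : ∀ S : Finset Vt, b ∉ S → ∀ y : ∀ v, 𝔛 v, (∀ v ∉ ({b} : Finset Vt), y v = x v) →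
      marg G.V q S y = marg G.V q S x := fun S hbS y hy =>
    marg_eq_of_agree fun v hv => hy v fun hvb => hv <| by
      rw [mem_singleton.1 hvb]
      exact mem_sdiff.2 ⟨hbV, hbS⟩
  rw [← sumOver_singleton_marg hbA hbV, ← sumOver_singleton_marg (q := q) hbA hbV]
  set n := A.erase b \ deF G s with hn
  have hbn : b ∉ n := by simp [hn]
  have hbsn : b ∉ insert s n := by simp [hbn, hbs]
  rw [mul_comm, ← sumOver_const_mul]
  by_cases hbd : b ∈ deF G s
  · have hnA : A \ deF G s = n := by
      ext v
      simp only [hn, mem_sdiff, mem_erase]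
      grind
    refine sumOver_congr fun y hy => ?_
    rw [h, hnA, hconst n hbn y hy, hconst _ hbsn y hy, mul_comm]
  have hnA : A \ deF G s = insert b n := by
    ext v
    simp only [hn, mem_sdiff, mem_erase, mem_insert]
    grind
  rw [hnA] at h
  by_cases hbi : Relation.ReflTransGen G.bi s b
  · have hprod := hM.marg_mul_marg hq hWF.1 hWF.2.2.2.1 (C := insert s n) hbV hAVW hA hchild
      (by grind) hbsn hbA
      (fun u huA hu hub => by
        by_cases hus : u ∈ deF G s
        · rw [hs.eq_of_bi hWF (hbi.trans hu) hus]
          exact mem_insert_self _ _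
        · simp [hn, huA, hub, hus])
      (fun u huA hu p hp => by
        have hpb : p ≠ b := by
          rintro rfl
          exact hchild u huA hp
        have := hs.parent_not_mem_deF hWF (hbi.trans hu) hp
        simp [hn, hA u huA p hp, hpb, this])
    have hc := fun y hy => hconst (insert s n) hbsn y hy
    rw [show sumOver {b} (fun y => marg G.V q n x / marg G.V q (insert s n) x * marg G.V q A y) x
      = sumOver {b} (fun y => marg G.V q (A.erase b) x / marg G.V q (insert s n) x *
          marg G.V q (insert b n) y) x from ?_]
    · refine sumOver_congr fun y hy => ?_
      have hA' := hconst (A.erase b) (by simp) y hy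
      rw [h, ← hA', ← hc y hy]
      have hp := hprod y
      rw [insert_comm b s n] at hp
      rcases (marg_nonneg (V := G.V) hq (insert s (insert b n)) y).eq_or_lt' with h0 | h0
      · rw [h0, div_zero, mul_zero]
        rcases (marg_nonneg (V := G.V) hq (insert b n) y).eq_or_lt' with h1 | h1
        · rw [h1, mul_zero]
        rcases (marg_nonneg (V := G.V) hq (A.erase b) y).eq_or_lt' with h2 | h2
        · rw [h2, zero_div, zero_mul]
        · have h3 := marg_pos_mono hq (T := {s}) (by simp [hsA, hbs.symm]) h2
          have h4 := marg_insert_pos hWF hq hs.1 hMs (N := insert b n) ?_ h1 h3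
          · exact (h4.ne' h0).elim
          · rw [← hnA]
            exact sdiff_disjoint
      · have h5 := marg_pos_mono hq (insert_subset_insert s (subset_insert b n)) h0
        field_simp
        linear_combination marg G.V q (insert b n) y * hp
    · rw [sumOver_const_mul, sumOver_const_mul, sumOver_singleton_marg hbA hbV,
        sumOver_singleton_marg (mem_insert_self _ _) hbV, erase_insert hbn]
      ring
  · have hprod := hM.marg_mul_marg hq hWF.1 hWF.2.2.2.1 (A := insert s (insert b n)) (C := n)
      (t := s) hs.1 (by grind) ?_ ?_ (by grind) (by simp [hn, hsd]) (mem_insert_self _ _) ?_ ?_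
    · refine sumOver_congr fun y hy => ?_
      rw [h, ← hconst n hbn y hy, ← hconst _ hbsn y hy]
      have hp := hprod y
      rw [erase_insert (by simp [hbs.symm, hn, hsd])] at hp
      rcases (marg_nonneg (V := G.V) hq A y).eq_or_lt' with h0 | h0
      · simp [h0]
      · have h1 := marg_pos_mono hq (T := insert s (insert b n)) (by grind) h0
        have h2 := marg_pos_mono hq (T := insert s n) (by grind) h0
        field_simp
        linear_combination -hp
    · rw [← hnA]
      intro a ha p hp
      have hpA : p ∈ A := hA a (by grind) p hp
      refine mem_insert_of_mem (mem_sdiff.2 ⟨hpA, fun hpd => ?_⟩)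
      rcases mem_insert.1 ha with rfl | ha
      · exact not_mem_deF_of_dir hWF hs.1 hp hpd
      · exact (mem_sdiff.1 ha).2 (deF_of_dir hWF hs.1 hpd hp)
    · rw [← hnA]
      intro a ha hsa
      have had := deF_of_dir hWF hs.1 hsd hsa
      rcases mem_insert.1 ha with rfl | ha
      · exact not_mem_deF_of_dir hWF hs.1 hsa had
      · exact (mem_sdiff.1 ha).2 had
    · intro u hu hsu hus
      have hub : u ≠ b := by
        rintro rfl
        exact hbi hsu
      simpa [hus, hub] using hu
    · intro u hu hsu p hp
      have huA : u ∈ A := by grind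
      have hpb : p ≠ b := by
        rintro rfl
        exact hchild u huA hp
      simp [hn, hpb, hA u huA p hp, hs.parent_not_mem_deF hWF hsu hp]

/-- In the fixed kernel, conditioning another fixable vertex on its Markov blanket amounts to
conditioning it on its non-descendants in the original graph and the fixed vertex. -/
theorem condOn_fixK_eq (hWF : G.WF) (hq : ∀ x, 0 ≤ q x) {r s : Vt}
    (hr : fixable G r) (hs : fixable G s) (hrs : r ≠ s)
    (hMs : Pcm (fixG G s) (fixK G s q)) {x : ∀ v, 𝔛 v} (hx : 0 < q x) :
    condOn (fixG G s).V (fixK G s q) r (mb (fixG G s) r) x =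
      marg G.V (fixK G s q) (insert s (insert r (ndF G r))) x /
        marg G.V (fixK G s q) (insert s (ndF G r)) x := by
  have hq' : ∀ x, 0 ≤ fixK G s q x := fixK_nonneg hq s
  have hx' : 0 < fixK G s q x := (fixK_pos_iff hq s).2 hx
  have hrn : r ∉ ndF G r := fun h => (mem_sdiff.1 h).2 (self_mem_deF hr.1)
  have hmarg : ∀ S : Finset Vt, s ∈ S →
      marg (fixG G s).V (fixK G s q) S x = marg G.V (fixK G s q) S x := by
    intro S hS
    unfold marg
    congr 1
    ext v
    simp only [fixG]
    grind
  have hunion : (fixG G s).V ∪ (fixG G s).W = G.V ∪ G.W := by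
    have := hs.1
    ext v
    simp only [fixG]
    grind
  have h := hMs.marg_mul_marg_mb hq' (A := insert s (insert r (ndF G r))) (t := r) ?_ ?_ ?_
    (mem_erase.2 ⟨hrs, hr.1⟩) ?_ ?_ ?_ ?_ (by simp) x
  · have e : (insert s (insert r (ndF G r))).erase r = insert s (ndF G r) := by
      rw [insert_comm, erase_insert (by simp [hrs, hrn])]
    rw [e, hmarg _ (mem_insert_self _ _), hmarg _ (mem_insert_self _ _)] at h
    rw [condOn_eq_div, div_eq_div_iff (marg_pos hq' _ hx').ne' (marg_pos hq' _ hx').ne', h]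
  · rw [disjoint_left]
    intro v hv
    have : v ∈ G.V → v ∉ G.W := fun hv => disjoint_left.1 hWF.1 hv
    simp only [fixG] at hv ⊢
    grind
  · intro a b hab
    have := hWF.2.2.2.1 _ _ hab.1
    exact ⟨mem_erase.2 ⟨hab.2.1, this.1⟩, mem_erase.2 ⟨hab.2.2, this.2⟩⟩
  · intro a b hab
    rw [hunion]
    exact (hWF.mem_of_dir hab.1)
  · rw [hunion]
    exact insert_subset (mem_union_left _ hs.1)
      (insert_subset (mem_union_left _ hr.1) sdiff_subset)
  · intro a ha b hba
    rcases mem_insert.1 ha with rfl | ha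
    · exact (hba.2 rfl).elim
    · exact mem_insert_of_mem (ancestral_insert_ndF hWF hr.1 a ha b hba.1)
  · intro a ha hra
    have had := deF_of_dir hWF hr.1 (self_mem_deF hr.1) hra.1
    rcases mem_insert.1 ha with rfl | ha
    · exact hra.2 rfl
    rcases mem_insert.1 ha with rfl | ha
    · exact not_mem_deF_of_dir hWF hr.1 hra.1 had
    · exact (mem_sdiff.1 ha).2 had
  · refine (mb_fixG_subset hs.1 r).trans ((hr.mb_subset_ndF hWF).trans ?_)
    exact (subset_insert _ _).trans (subset_insert _ _)

variable [Fintype Vt]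

/-- An ancestral set missing some random vertex can be enlarged by a single vertex. -/
theorem exists_ancestral_insert (hWF : G.WF) {A : Finset Vt} (hWA : G.W ⊆ A)
    (hne : (G.V \ A).Nonempty) :
    ∃ b ∈ G.V \ A, ∀ p, G.dir p b → p ∈ A := by
  have : IsTrans Vt (Relation.TransGen G.dir) := ⟨fun _ _ _ => Relation.TransGen.trans⟩
  have : Std.Irrefl (Relation.TransGen G.dir) := ⟨hWF.2.2.2.2⟩
  obtain ⟨b, hb, hmin⟩ := (Finite.wellFounded_of_trans_of_irrefl
    (Relation.TransGen G.dir)).has_min (↑(G.V \ A)) hne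
  refine ⟨b, hb, fun p hp => ?_⟩
  by_contra hpA
  refine hmin p ?_ (.single hp)
  rcases mem_union.1 (hWF.mem_of_dir hp) with h | h
  · exact mem_sdiff.2 ⟨h, hpA⟩
  · exact (hpA (hWA h)).elim

/-- Ancestral margins of the fixed kernel. -/
theorem marg_fixK (hWF : G.WF) (hq : ∀ x, 0 ≤ q x) (hM : Pcm G q) {s : Vt}
    (hs : fixable G s) (hMs : Pcm (fixG G s) (fixK G s q)) {A : Finset Vt}
    (hAVW : A ⊆ G.V ∪ G.W) (hWA : G.W ⊆ A) (hA : ∀ a ∈ A, ∀ b, G.dir b a → b ∈ A)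
    (hsA : s ∈ A) (x : ∀ v, 𝔛 v) :
    marg G.V (fixK G s q) A x = marg G.V q A x *
      (marg G.V q (A \ deF G s) x / marg G.V q (insert s (A \ deF G s)) x) := by
  induction hk : #(G.V \ A) generalizing A x with
  | zero =>
    have hVA : G.V \ A = ∅ := card_eq_zero.1 hk
    have hAeq : A = G.V ∪ G.W :=
      hAVW.antisymm (union_subset (sdiff_eq_empty_iff_subset.1 hVA) hWA)
    have e : A \ deF G s = ndF G s := by rw [hAeq, ndF]
    rw [e]
    unfold marg
    rw [hVA, sumOver_empty, sumOver_empty]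
    rcases (hq x).eq_or_lt' with h0 | h0
    · simp [fixK, h0]
    · rw [fixK, condOn_mb_eq hWF hq hM hs h0, div_eq_mul_inv, inv_div]
      rfl
  | succ k ih =>
    obtain ⟨b, hb, hpar⟩ := exists_ancestral_insert hWF hWA (card_pos.1 (by omega))
    obtain ⟨hbV, hbA⟩ := mem_sdiff.1 hb
    have hanc : ∀ a ∈ insert b A, ∀ p, G.dir p a → p ∈ insert b A := by
      intro a ha p hp
      rcases mem_insert.1 ha with rfl | ha
      · exact mem_insert_of_mem (hpar p hp)
      · exact mem_insert_of_mem (hA a ha p hp)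
    have hsub : insert b A ⊆ G.V ∪ G.W := insert_subset (mem_union_left _ hbV) hAVW
    have hcard : #(G.V \ insert b A) = k := by
      rw [sdiff_insert, card_erase_of_mem hb, hk, Nat.add_sub_cancel]
    have := marg_fixK_erase hWF hq hM hs hMs (A := insert b A) (b := b) hsub hanc
      (mem_insert_of_mem hsA) (mem_insert_self _ _) hbV (by rintro rfl; exact hbA hsA) ?_
      (fun x => ih hsub (hWA.trans (subset_insert _ _)) hanc (mem_insert_of_mem hsA) x hcard) x
    · rwa [erase_insert hbA] at this
    · intro a ha hba
      rcases mem_insert.1 ha with rfl | ha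
      · exact hbA (hpar _ hba)
      · exact hbA (hA a ha _ hba)

/-- Margins of the fixed kernel on non-descendants of the fixed vertex are unchanged. -/
theorem marg_fixK_of_subset_ndF (hWF : G.WF) (hq : ∀ x, 0 ≤ q x) (hM : Pcm G q) {s : Vt}
    (hs : fixable G s) (hMs : Pcm (fixG G s) (fixK G s q)) {Z : Finset Vt} (hZ : Z ⊆ ndF G s)
    {x : ∀ v, 𝔛 v} (hx : 0 < marg G.V q {s} x) :
    marg G.V (fixK G s q) (insert s Z) x = marg G.V q Z x := by
  have hsd := self_mem_deF hs.1
  have hsn : s ∉ ndF G s := fun h => (mem_sdiff.1 h).2 hsd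
  have hdisj : Disjoint (ndF G s) (deF G s) := sdiff_disjoint
  have hsub : insert s (ndF G s) ⊆ G.V ∪ G.W :=
    insert_subset (mem_union_left _ hs.1) sdiff_subset
  have e : insert s (ndF G s) \ deF G s = ndF G s := by
    rw [insert_sdiff_of_mem _ hsd, hdisj.sdiff_eq_left]
  rw [← sumOver_marg (R := (G.V ∩ ndF G s) \ Z) (S := insert s (ndF G s)) (T := insert s Z)
      (by ext v; have := @hZ v; grind) (by rw [disjoint_left]; grind),
    ← sumOver_marg (q := q) (R := (G.V ∩ ndF G s) \ Z) (S := ndF G s) (T := Z)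
      (by ext v; have := @hZ v; grind) (by rw [disjoint_left]; grind)]
  refine sumOver_congr fun y hy => ?_
  rw [marg_fixK hWF hq hM hs hMs hsub ((subset_ndF_W hWF hs.1).trans (subset_insert _ _))
    (ancestral_insert_ndF hWF hs.1) (mem_insert_self _ _), e]
  have hys : 0 < marg G.V q {s} y := by
    rw [marg_eq_of_agree (x := x)]
    · exact hx
    · intro v hv
      refine hy v fun h => hv ?_
      grind
  rcases (marg_nonneg (V := G.V) hq (ndF G s) y).eq_or_lt' with h0 | h0
  · simp [h0]
  · have := marg_insert_pos hWF hq hs.1 hMs hdisj h0 hys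
    field_simp

/-- If `s` is a descendant of `r`, fixing `s` leaves the conditional kernel of `r` unchanged. -/
theorem condOn_fixK_of_mem_deF (hWF : G.WF) (hq : ∀ x, 0 ≤ q x) (hM : Pcm G q) {r s : Vt}
    (hr : fixable G r) (hs : fixable G s) (hrs : r ≠ s)
    (hMs : Pcm (fixG G s) (fixK G s q)) (hsr : s ∈ deF G r) {x : ∀ v, 𝔛 v} (hx : 0 < q x) :
    condOn (fixG G s).V (fixK G s q) r (mb (fixG G s) r) x = condOn G.V q r (mb G r) x := by
  have hsub : ndF G r ⊆ ndF G s := sdiff_subset_sdiff Subset.rfl (deF_subset_deF hWF hs.1 hr.1 hsr)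
  have hrn : r ∈ ndF G s := mem_sdiff.2 ⟨mem_union_left _ hr.1,
    not_mem_deF_of_mem_deF hWF hs.1 hr.1 hrs.symm hsr⟩
  rw [condOn_fixK_eq hWF hq hr hs hrs hMs hx, condOn_mb_eq hWF hq hM hr hx,
    marg_fixK_of_subset_ndF hWF hq hM hs hMs (insert_subset hrn hsub) (marg_pos hq _ hx),
    marg_fixK_of_subset_ndF hWF hq hM hs hMs hsub (marg_pos hq _ hx)]

theorem condOn_fixK_eq_mul (hWF : G.WF) (hq : ∀ x, 0 ≤ q x) (hM : Pcm G q) {r s : Vt}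
    (hr : fixable G r) (hs : fixable G s) (hrs : r ≠ s)
    (hMs : Pcm (fixG G s) (fixK G s q)) (hsr : s ∉ deF G r) {x : ∀ v, 𝔛 v} (hx : 0 < q x) :
    condOn (fixG G s).V (fixK G s q) r (mb (fixG G s) r) x =
      condOn G.V q r (mb G r) x *
        ((marg G.V q (insert r (ndF G r) \ deF G s) x * marg G.V q (insert s (ndF G r \ deF G s)) x)
        / (marg G.V q (insert s (insert r (ndF G r) \ deF G s)) x *
          marg G.V q (ndF G r \ deF G s) x)) := by
  have hsn : s ∈ ndF G r := mem_sdiff.2 ⟨mem_union_left _ hs.1, hsr⟩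
  have hW := subset_ndF_W hWF hr.1
  rw [condOn_fixK_eq hWF hq hr hs hrs hMs hx, condOn_mb_eq hWF hq hM hr hx,
    insert_eq_of_mem (mem_insert_of_mem hsn), insert_eq_of_mem hsn,
    marg_fixK (A := insert r (ndF G r)) hWF hq hM hs hMs
      (insert_subset (mem_union_left _ hr.1) sdiff_subset)
      (hW.trans (subset_insert _ _)) (ancestral_insert_ndF hWF hr.1) (mem_insert_of_mem hsn),
    marg_fixK (A := ndF G r) hWF hq hM hs hMs sdiff_subset hW (ancestral_ndF hWF hr.1) hsn]
  have hp := fun S => (marg_pos (V := G.V) hq S hx).ne'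
  have h1 := hp (ndF G r)
  have h2 := hp (insert s (ndF G r \ deF G s))
  have h3 := hp (ndF G r \ deF G s)
  have h4 := hp (insert s (insert r (ndF G r) \ deF G s))
  field_simp

/-- The factor by which fixing commutes, when one of the vertices descends from the other. -/
theorem condOn_mul_condOn_fixK_of_mem_deF (hWF : G.WF) (hq : ∀ x, 0 ≤ q x) (hM : Pcm G q)
    {r s : Vt} (hr : fixable G r) (hs : fixable G s) (hrs : r ≠ s)
    (hMr : Pcm (fixG G r) (fixK G r q)) (hMs : Pcm (fixG G s) (fixK G s q))
    (hsr : s ∈ deF G r) {x : ∀ v, 𝔛 v} (hx : 0 < q x) :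
    condOn G.V q s (mb G s) x * condOn (fixG G s).V (fixK G s q) r (mb (fixG G s) r) x =
      condOn G.V q r (mb G r) x * condOn (fixG G r).V (fixK G r q) s (mb (fixG G r) s) x := by
  have hrs' : r ∉ deF G s := not_mem_deF_of_mem_deF hWF hs.1 hr.1 hrs.symm hsr
  have e : insert s (ndF G s) \ deF G r = ndF G s \ deF G r := insert_sdiff_of_mem _ hsr
  rw [condOn_fixK_of_mem_deF hWF hq hM hr hs hrs hMs hsr hx,
    condOn_fixK_eq_mul hWF hq hM hs hr hrs.symm hMr hrs' hx, e, mul_comm (marg _ _ _ _),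
    div_self (mul_pos (marg_pos hq _ hx) (marg_pos hq _ hx)).ne', mul_one, mul_comm]

theorem condOn_mul_condOn_fixK (hWF : G.WF) (hq : ∀ x, 0 ≤ q x) (hM : Pcm G q)
    {r s : Vt} (hr : fixable G r) (hs : fixable G s) (hrs : r ≠ s)
    (hMr : Pcm (fixG G r) (fixK G r q)) (hMs : Pcm (fixG G s) (fixK G s q))
    {x : ∀ v, 𝔛 v} (hx : 0 < q x) :
    condOn G.V q s (mb G s) x * condOn (fixG G s).V (fixK G s q) r (mb (fixG G s) r) x =
      condOn G.V q r (mb G r) x * condOn (fixG G r).V (fixK G r q) s (mb (fixG G r) s) x := by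
  by_cases hsr : s ∈ deF G r
  · exact condOn_mul_condOn_fixK_of_mem_deF hWF hq hM hr hs hrs hMr hMs hsr hx
  by_cases hrs' : r ∈ deF G s
  · exact (condOn_mul_condOn_fixK_of_mem_deF hWF hq hM hs hr hrs.symm hMs hMr hrs' hx).symm
  have e : ndF G s \ deF G r = ndF G r \ deF G s := sdiff_right_comm _ _ _
  rw [condOn_fixK_eq_mul hWF hq hM hr hs hrs hMs hsr hx,
    condOn_fixK_eq_mul hWF hq hM hs hr hrs.symm hMr hrs' hx,
    insert_sdiff_of_notMem _ hrs', insert_sdiff_of_notMem _ hsr, e, insert_comm r s]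
  ring

end Fixing

end Nested

open Nested in
/-- if `q_V` is Markov w.r.t. `𝒢`, `r, s ∈ 𝔽(𝒢)`, and
`φ_r(q_V; 𝒢)`, `φ_s(q_V; 𝒢)` are Markov w.r.t. `φ_r(𝒢)`, `φ_s(𝒢)`
respectively, then `φ_r ∘ φ_s(𝒢) = φ_s ∘ φ_r(𝒢)` and
`φ_r ∘ φ_s(q_V; 𝒢) = φ_s ∘ φ_r(q_V; 𝒢)`. -/
theorem fixing_commutes
    {Vt : Type} [Fintype Vt] [DecidableEq Vt]
    {𝔛 : Vt → Type} [∀ v, Fintype (𝔛 v)]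
    (G : PreCADMG Vt) (hWF : G.WF)
    (q : (∀ v, 𝔛 v) → ℝ) (hq : IsKernel G.V G.W q)
    (hM : Pcm G q)
    (r s : Vt) (hr : fixable G r) (hs : fixable G s)
    (hMr : Pcm (fixG G r) (fixK G r q))
    (hMs : Pcm (fixG G s) (fixK G s q)) :
    fixG (fixG G s) r = fixG (fixG G r) s ∧
    fixK (fixG G s) r (fixK G s q) = fixK (fixG G r) s (fixK G r q) := by
  refine ⟨fixG_comm G r s, funext fun x => ?_⟩
  rcases eq_or_ne r s with rfl | hrs
  · rfl
  rcases (hq.1 x).eq_or_lt' with hx | hx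
  · simp [fixK, hx]
  · change q x / condOn G.V q s (mb G s) x /
        condOn (fixG G s).V (fixK G s q) r (mb (fixG G s) r) x =
      q x / condOn G.V q r (mb G r) x / condOn (fixG G r).V (fixK G r q) s (mb (fixG G r) s) x
    rw [div_div, div_div, condOn_mul_condOn_fixK hWF hq.1 hM hr hs hrs hMr hMs hx]
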